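/- arXiv:math/0003022 — 7 statements merged into one kernel-verified Lean document; each statement's English description precedes it below -/
import Mathlib

section
/- For all ξ, η ∈ ℝⁿ one has |f(ξ) − f(η)| · |η|^{1−ν} ≤ |ξ − η|^{1−ν} · f(ξ − η) · f(η). (Estimate (3.5) of Lemma 3.1.) -/
/-- The Gevrey weight `f(ξ) = exp(ρ · max(|ξ|^ν, 1))`. -/
noncomputable def fgev {n : ℕ} (ν ρ : ℝ) (ξ : EuclideanSpace ℝ (Fin n)) : ℝ :=
  Real.exp (ρ * max (‖ξ‖ ^ ν) 1)

/-- For exponents in `[0, 1]` the increment of `x ↦ x ^ ν` from a positive point `b` is bounded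
linearly with slope `b ^ (ν - 1)`. -/
lemma abs_rpow_sub_rpow_mul_le {a b ν : ℝ} (ha : 0 ≤ a) (hb : 0 < b) (hν0 : 0 ≤ ν)
    (hν1 : ν ≤ 1) : |a ^ ν - b ^ ν| * b ^ (1 - ν) ≤ |a - b| := by
  obtain ⟨r, rfl⟩ : ∃ r, a = r * b := ⟨a / b, by field_simp⟩
  have hr : 0 ≤ r := nonneg_of_mul_nonneg_left ha hb
  have hbb : b ^ ν * b ^ (1 - ν) = b := by
    rw [← Real.rpow_add hb]
    simp
  have hle : |r ^ ν - 1| ≤ |r - 1| := by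
    rcases le_total 1 r with h | h
    · have h1 : r ^ ν ≤ r := by simpa using Real.rpow_le_rpow_of_exponent_le h hν1
      have h2 := Real.one_le_rpow h hν0
      rw [abs_of_nonneg (by linarith), abs_of_nonneg (by linarith)]
      linarith
    · have h1 : r ≤ r ^ ν := Real.self_le_rpow_of_le_one hr h hν1
      have h2 := Real.rpow_le_one hr h hν0
      rw [abs_of_nonpos (by linarith), abs_of_nonpos (by linarith)]
      linarith
  calc |(r * b) ^ ν - b ^ ν| * b ^ (1 - ν)
      = |r ^ ν - 1| * (b ^ ν * b ^ (1 - ν)) := by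
        rw [Real.mul_rpow hr hb.le, ← sub_one_mul, abs_mul,
          abs_of_nonneg (Real.rpow_nonneg hb.le ν), mul_assoc]
    _ ≤ |r - 1| * b := by
        rw [hbb]
        gcongr
    _ = |r * b - b| := by rw [← sub_one_mul, abs_mul, abs_of_pos hb]

lemma abs_exp_sub_one_le_exp_abs_sub_one (x : ℝ) : |Real.exp x - 1| ≤ Real.exp |x| - 1 := by
  rcases le_total 0 x with h | h
  · rw [abs_of_nonneg h, abs_of_nonneg (by linarith [Real.one_le_exp h])]
  · rw [abs_of_nonpos h, abs_of_nonpos (by linarith [Real.exp_le_one_iff.2 h])]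
    linarith [Real.add_one_le_exp x, Real.add_one_le_exp (-x)]

lemma exp_mul_sub_one_le {t : ℝ} (ht0 : 0 ≤ t) (ht1 : t ≤ 1) (x : ℝ) :
    Real.exp (t * x) - 1 ≤ t * (Real.exp x - 1) := by
  have h := convexOn_exp.2 (Set.mem_univ x) (Set.mem_univ 0) ht0 (sub_nonneg.2 ht1)
    (add_sub_cancel t 1)
  simp only [smul_eq_mul, mul_zero, add_zero, Real.exp_zero, mul_one] at h
  linarith

/-- Estimate (3.5) of Lemma 3.1: for all `ξ, η ∈ ℝⁿ`,
`|f(ξ) − f(η)| · |η|^{1−ν} ≤ |ξ − η|^{1−ν} · f(ξ − η) · f(η)`. -/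
theorem stmt2 (n : ℕ) (hn : 1 ≤ n) (ν ρ : ℝ) (hν0 : 0 < ν) (hν1 : ν ≤ 1) (hρ : 0 < ρ)
    (ξ η : EuclideanSpace ℝ (Fin n)) :
    |fgev ν ρ ξ - fgev ν ρ η| * ‖η‖ ^ (1 - ν) ≤
      ‖ξ - η‖ ^ (1 - ν) * fgev ν ρ (ξ - η) * fgev ν ρ η := by
  have hac : ‖ξ‖ ≤ ‖η‖ + ‖ξ - η‖ := norm_le_norm_add_norm_sub' ξ η
  have habs : |‖ξ‖ - ‖η‖| ≤ ‖ξ - η‖ := abs_norm_sub_norm_le ξ η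
  have ha := norm_nonneg ξ
  have hb := norm_nonneg η
  have hc := norm_nonneg (ξ - η)
  unfold fgev
  generalize ‖ξ - η‖ = c at *
  generalize ‖ξ‖ = a at *
  generalize ‖η‖ = b at *
  rcases le_or_gt b c with hbc | hbc
  · have hpow : b ^ (1 - ν) ≤ c ^ (1 - ν) := Real.rpow_le_rpow hb hbc (by linarith)
    have hsub : a ^ ν ≤ b ^ ν + c ^ ν :=
      (Real.rpow_le_rpow ha hac hν0.le).trans (Real.rpow_add_le_add_rpow hb hc hν0.le hν1)
    have hmax : max (a ^ ν) 1 ≤ max (c ^ ν) 1 + max (b ^ ν) 1 :=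
      max_le
        (by linarith [le_max_left (b ^ ν) 1, le_max_left (c ^ ν) 1])
        (by linarith [le_max_right (b ^ ν) 1, le_max_right (c ^ ν) 1])
    have hF : Real.exp (ρ * max (a ^ ν) 1) ≤
        Real.exp (ρ * max (c ^ ν) 1) * Real.exp (ρ * max (b ^ ν) 1) := by
      rw [← Real.exp_add, ← mul_add]
      gcongr
    have hFb : Real.exp (ρ * max (b ^ ν) 1) ≤
        Real.exp (ρ * max (c ^ ν) 1) * Real.exp (ρ * max (b ^ ν) 1) :=
      le_mul_of_one_le_left (Real.exp_nonneg _) (Real.one_le_exp (by positivity))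
    have hdiff : |Real.exp (ρ * max (a ^ ν) 1) - Real.exp (ρ * max (b ^ ν) 1)| ≤
        Real.exp (ρ * max (c ^ ν) 1) * Real.exp (ρ * max (b ^ ν) 1) :=
      abs_sub_le_of_nonneg_of_le (Real.exp_nonneg _) hF (Real.exp_nonneg _) hFb
    calc _ ≤ (Real.exp (ρ * max (c ^ ν) 1) * Real.exp (ρ * max (b ^ ν) 1)) * c ^ (1 - ν) := by
          gcongr
      _ = _ := by ring
  · have hb0 : 0 < b := hc.trans_lt hbc
    have hbpos : 0 < b ^ (1 - ν) := Real.rpow_pos_of_pos hb0 _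
    obtain ⟨t, ht⟩ : ∃ t, c ^ (1 - ν) = t * b ^ (1 - ν) :=
      ⟨c ^ (1 - ν) / b ^ (1 - ν), by field_simp⟩
    have ht0 : 0 ≤ t := nonneg_of_mul_nonneg_left (ht ▸ Real.rpow_nonneg hc _) hbpos
    have ht1 : t ≤ 1 := by
      have h := Real.rpow_le_rpow hc hbc.le (sub_nonneg.2 hν1)
      rw [ht] at h
      exact le_of_mul_le_mul_right (by linarith) hbpos
    have hcc : c = c ^ ν * c ^ (1 - ν) := by
      rw [← Real.rpow_add_of_nonneg hc hν0.le (sub_nonneg.2 hν1)]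
      simp
    have hD : |max (a ^ ν) 1 - max (b ^ ν) 1| ≤ t * c ^ ν := by
      refine (abs_max_sub_max_le_abs _ _ _).trans (le_of_mul_le_mul_right ?_ hbpos)
      calc |a ^ ν - b ^ ν| * b ^ (1 - ν) ≤ c :=
            (abs_rpow_sub_rpow_mul_le ha hb0 hν0.le hν1).trans habs
        _ = c ^ ν * c ^ (1 - ν) := hcc
        _ = t * c ^ ν * b ^ (1 - ν) := by
            rw [ht]
            ring
    have hfactor : Real.exp (ρ * max (a ^ ν) 1) - Real.exp (ρ * max (b ^ ν) 1) =
        (Real.exp (ρ * (max (a ^ ν) 1 - max (b ^ ν) 1)) - 1) *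
          Real.exp (ρ * max (b ^ ν) 1) := by
      rw [sub_one_mul, ← Real.exp_add]
      ring_nf
    have hexp : |Real.exp (ρ * (max (a ^ ν) 1 - max (b ^ ν) 1)) - 1| ≤
        t * Real.exp (ρ * max (c ^ ν) 1) :=
      calc _ ≤ Real.exp |ρ * (max (a ^ ν) 1 - max (b ^ ν) 1)| - 1 :=
            abs_exp_sub_one_le_exp_abs_sub_one _
        _ ≤ Real.exp (t * (ρ * max (c ^ ν) 1)) - 1 := by
            rw [abs_mul, abs_of_pos hρ, mul_left_comm]
            gcongr
            exact hD.trans (by gcongr; exact le_max_left _ _)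
        _ ≤ t * (Real.exp (ρ * max (c ^ ν) 1) - 1) := exp_mul_sub_one_le ht0 ht1 _
        _ ≤ t * Real.exp (ρ * max (c ^ ν) 1) := by
            gcongr
            linarith
    rw [hfactor, abs_mul, abs_of_pos (Real.exp_pos _), ht]
    calc _ ≤ t * Real.exp (ρ * max (c ^ ν) 1) * Real.exp (ρ * max (b ^ ν) 1) * b ^ (1 - ν) := by
          gcongr
      _ = _ := by ring
end

section
/- For all ξ, η ∈ ℝⁿ with min(|ξ|, |η|) ≤ |ξ − η|, one has |f(ξ) − f(η)| · |η|^{1−ν} ≤ 2^{1−ν} · |ξ − η|^{1−ν} · f(ξ − η) · f₀(η)^ν; moreover the constant 2^{1−ν} can be replaced by 1 except in the region |ξ| ≤ |ξ − η| ≤ |η|. (Estimate (3.7) of Lemma 3.1.) -/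
/-- The Gevrey weight `f₀(ξ) = exp(ρ |ξ|^ν)`. -/
noncomputable def f0gev {n : ℕ} (ν ρ : ℝ) (ξ : EuclideanSpace ℝ (Fin n)) : ℝ :=
  Real.exp (ρ * ‖ξ‖ ^ ν)

/-- Bernoulli's inequality for exponents in `[0, 1]`, in homogeneous form. -/
theorem rpow_add_le_rpow_add_mul_rpow {ν s z : ℝ} (hν0 : 0 < ν) (hν1 : ν ≤ 1)
    (hs : 0 ≤ s) (hsz : s ≤ z) : (s + z) ^ ν ≤ z ^ ν + ν * s ^ ν := by
  rcases (hs.trans hsz).eq_or_lt with hz | hz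
  · obtain rfl : s = 0 := by linarith
    simp [← hz, Real.zero_rpow hν0.ne']
  · have ht : 0 ≤ s / z := by positivity
    have hle : s / z ≤ (s / z) ^ ν := by
      simpa using Real.rpow_le_rpow_of_exponent_ge' ht ((div_le_one hz).2 hsz) hν0.le hν1
    have hb : (1 + s / z) ^ ν ≤ 1 + ν * (s / z) :=
      rpow_one_add_le_one_add_mul_self (by linarith) hν0.le hν1
    calc (s + z) ^ ν = (z * (1 + s / z)) ^ ν := by congr 1; field_simp; ring
      _ = z ^ ν * (1 + s / z) ^ ν := Real.mul_rpow hz.le (by positivity)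
      _ ≤ z ^ ν * (1 + ν * (s / z) ^ ν) := by gcongr; exact hb.trans (by gcongr)
      _ = z ^ ν + ν * (z ^ ν * (s / z) ^ ν) := by ring
      _ = z ^ ν + ν * s ^ ν := by
        rw [← Real.mul_rpow hz.le ht, mul_div_cancel₀ _ hz.ne']

theorem fgev_le_fgev_mul_f0gev_rpow {n : ℕ} {ν ρ s : ℝ} (hν0 : 0 < ν) (hν1 : ν ≤ 1)
    (hρ : 0 < ρ) {a z y : EuclideanSpace ℝ (Fin n)} (hs : 0 ≤ s) (hsz : s ≤ ‖z‖)
    (hsy : s ≤ ‖y‖) (ha : ‖a‖ ≤ s + ‖z‖) :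
    fgev ν ρ a ≤ fgev ν ρ z * f0gev ν ρ y ^ ν := by
  have hy : 0 ≤ ν * ‖y‖ ^ ν := by positivity
  have hexp : max (‖a‖ ^ ν) 1 ≤ max (‖z‖ ^ ν) 1 + ν * ‖y‖ ^ ν := by
    refine max_le ?_ ((le_max_right _ _).trans (le_add_of_nonneg_right hy))
    calc ‖a‖ ^ ν ≤ (s + ‖z‖) ^ ν := by gcongr
      _ ≤ ‖z‖ ^ ν + ν * s ^ ν := rpow_add_le_rpow_add_mul_rpow hν0 hν1 hs hsz
      _ ≤ max (‖z‖ ^ ν) 1 + ν * ‖y‖ ^ ν := by gcongr; exact le_max_left _ _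
  unfold fgev f0gev
  rw [← Real.exp_mul, ← Real.exp_add]
  refine Real.exp_le_exp.2 ?_
  calc ρ * max (‖a‖ ^ ν) 1 ≤ ρ * (max (‖z‖ ^ ν) 1 + ν * ‖y‖ ^ ν) := by gcongr
    _ = _ := by ring

theorem abs_fgev_sub_fgev_le {n : ℕ} {ν ρ : ℝ} (hν0 : 0 < ν) (hν1 : ν ≤ 1) (hρ : 0 < ρ)
    {ξ η : EuclideanSpace ℝ (Fin n)} (hreg : min ‖ξ‖ ‖η‖ ≤ ‖ξ - η‖) :
    |fgev ν ρ ξ - fgev ν ρ η| ≤ fgev ν ρ (ξ - η) * f0gev ν ρ η ^ ν := by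
  have hx : ‖ξ‖ ≤ min ‖ξ‖ ‖η‖ + ‖ξ - η‖ := by
    rw [min_add]
    exact le_min (by linarith [norm_nonneg (ξ - η)]) (by linarith [norm_le_norm_add_norm_sub' ξ η])
  have hy : ‖η‖ ≤ min ‖ξ‖ ‖η‖ + ‖ξ - η‖ := by
    rw [min_add]
    exact le_min (by linarith [norm_le_norm_add_norm_sub ξ η]) (by linarith [norm_nonneg (ξ - η)])
  have hmin : 0 ≤ min ‖ξ‖ ‖η‖ := le_min (norm_nonneg _) (norm_nonneg _)
  have h₁ := fgev_le_fgev_mul_f0gev_rpow hν0 hν1 hρ hmin hreg (min_le_right _ _) hx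
  have h₂ := fgev_le_fgev_mul_f0gev_rpow hν0 hν1 hρ hmin hreg (min_le_right _ _) hy
  have p₁ : 0 < fgev ν ρ ξ := Real.exp_pos _
  have p₂ : 0 < fgev ν ρ η := Real.exp_pos _
  exact abs_sub_le_iff.2 ⟨by linarith, by linarith⟩

/-- Estimate (3.7) of Lemma 3.1: for all `ξ, η ∈ ℝⁿ` with `min(|ξ|, |η|) ≤ |ξ − η|`, one has
`|f(ξ) − f(η)| · |η|^{1−ν} ≤ 2^{1−ν} · |ξ − η|^{1−ν} · f(ξ − η) · f₀(η)^ν`; moreover the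
constant `2^{1−ν}` can be replaced by `1` except in the region `|ξ| ≤ |ξ − η| ≤ |η|`. -/
theorem stmt4 (n : ℕ) (hn : 1 ≤ n) (ν ρ : ℝ) (hν0 : 0 < ν) (hν1 : ν ≤ 1) (hρ : 0 < ρ)
    (ξ η : EuclideanSpace ℝ (Fin n)) (hreg : min ‖ξ‖ ‖η‖ ≤ ‖ξ - η‖) :
    |fgev ν ρ ξ - fgev ν ρ η| * ‖η‖ ^ (1 - ν) ≤
      (2 : ℝ) ^ (1 - ν) * ‖ξ - η‖ ^ (1 - ν) * fgev ν ρ (ξ - η) * f0gev ν ρ η ^ ν ∧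
    (¬ (‖ξ‖ ≤ ‖ξ - η‖ ∧ ‖ξ - η‖ ≤ ‖η‖) →
      |fgev ν ρ ξ - fgev ν ρ η| * ‖η‖ ^ (1 - ν) ≤
        ‖ξ - η‖ ^ (1 - ν) * fgev ν ρ (ξ - η) * f0gev ν ρ η ^ ν) := by
  have hf := abs_fgev_sub_fgev_le hν0 hν1 hρ hreg
  have hν : 0 ≤ 1 - ν := sub_nonneg.2 hν1
  constructor
  · have hy : ‖η‖ ≤ 2 * ‖ξ - η‖ := by
      rcases min_le_iff.1 hreg with h | h
      · linarith [norm_le_norm_add_norm_sub ξ η]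
      · linarith [norm_nonneg (ξ - η)]
    have hp : ‖η‖ ^ (1 - ν) ≤ 2 ^ (1 - ν) * ‖ξ - η‖ ^ (1 - ν) := by
      rw [← Real.mul_rpow zero_le_two (norm_nonneg _)]
      gcongr
    calc _ ≤ (fgev ν ρ (ξ - η) * f0gev ν ρ η ^ ν) * (2 ^ (1 - ν) * ‖ξ - η‖ ^ (1 - ν)) :=
          mul_le_mul hf hp (by positivity) ((abs_nonneg _).trans hf)
      _ = _ := by ring
  · intro hout
    have hy : ‖η‖ ≤ ‖ξ - η‖ := by
      by_contra! h
      exact hout ⟨(min_le_iff.1 hreg).resolve_right h.not_ge, h.le⟩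
    calc _ ≤ (fgev ν ρ (ξ - η) * f0gev ν ρ η ^ ν) * ‖ξ - η‖ ^ (1 - ν) :=
          mul_le_mul hf (by gcongr) (by positivity) ((abs_nonneg _).trans hf)
      _ = _ := by ring
end

section
/- For all ξ, η ∈ ℝⁿ one has |f₀(ξ) − f₀(η)| · |η|^{1−ν} ≤ |ξ − η|^{1−ν} · f₀(ξ − η) · f₀(η). (Estimate (3.5) of Lemma 3.1 for the function f₀.) -/
theorem abs_exp_sub_exp_mul_le {P Q t x y : ℝ} (hP : 0 ≤ P) (hQ : 0 ≤ Q) (h : |x - y| ≤ t)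
    (hPQ : |x - y| * P ≤ Q * t) :
    |Real.exp x - Real.exp y| * P ≤ Q * Real.exp t * Real.exp y := by
  have hfac : |Real.exp x - Real.exp y| = |Real.exp (x - y) - 1| * Real.exp y := by
    conv_rhs => rw [← abs_of_pos (Real.exp_pos y), ← abs_mul, sub_mul, ← Real.exp_add]
    simp
  have habs : |Real.exp (x - y) - 1| ≤ Real.exp |x - y| - 1 := by
    generalize x - y = z
    rcases le_total 0 z with hz | hz
    · rw [abs_of_nonneg hz, abs_of_nonneg (by linarith [Real.one_le_exp hz])]
    · rw [abs_of_nonpos hz, abs_of_nonpos (by linarith [Real.exp_le_one_iff.2 hz])]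
      linarith [Real.add_one_le_exp z, Real.add_one_le_exp (-z)]
  have key : (Real.exp |x - y| - 1) * P ≤ Q * Real.exp t := by
    rcases le_or_gt P Q with hle | hlt
    · calc (Real.exp |x - y| - 1) * P ≤ Real.exp t * P := by
            gcongr
            linarith [Real.exp_le_exp.2 h]
        _ ≤ Real.exp t * Q := by gcongr
        _ = Q * Real.exp t := mul_comm _ _
    · have hP0 : 0 < P := hQ.trans_lt hlt
      have hx : |x - y| ≤ Q / P * t := by
        rw [div_mul_eq_mul_div, le_div_iff₀ hP0]
        exact hPQ
      have hconv := convexOn_exp.2 (Set.mem_univ (0 : ℝ)) (Set.mem_univ t)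
        (sub_nonneg.2 ((div_le_one hP0).2 hlt.le)) (div_nonneg hQ hP) (sub_add_cancel 1 (Q / P))
      simp only [smul_eq_mul, mul_zero, zero_add, Real.exp_zero, mul_one] at hconv
      have hr : 0 ≤ Q / P := div_nonneg hQ hP
      calc (Real.exp |x - y| - 1) * P ≤ (Q / P * Real.exp t) * P := by
            gcongr
            linarith [Real.exp_le_exp.2 hx]
        _ = Q * Real.exp t := by field_simp
  calc |Real.exp x - Real.exp y| * P = |Real.exp (x - y) - 1| * P * Real.exp y := by
        rw [hfac]; ring
    _ ≤ (Real.exp |x - y| - 1) * P * Real.exp y := by gcongr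
    _ ≤ Q * Real.exp t * Real.exp y := by gcongr

theorem abs_rpow_sub_rpow_le {a b ν : ℝ} (ha : 0 ≤ a) (hb : 0 ≤ b) (hν0 : 0 ≤ ν) (hν1 : ν ≤ 1) :
    |b ^ ν - a ^ ν| ≤ |b - a| ^ ν := by
  have aux : ∀ {u v : ℝ}, 0 ≤ u → 0 ≤ v → u ^ ν - v ^ ν ≤ |u - v| ^ ν := by
    intro u v hu hv
    have h1 : u ^ ν ≤ (|u - v| + v) ^ ν :=
      Real.rpow_le_rpow hu (by linarith [le_abs_self (u - v)]) hν0
    linarith [Real.rpow_add_le_add_rpow (abs_nonneg (u - v)) hv hν0 hν1]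
  refine abs_sub_le_iff.2 ⟨aux hb ha, ?_⟩
  rw [abs_sub_comm]
  exact aux ha hb

theorem rpow_one_sub_mul_rpow_self {a ν : ℝ} (ha : 0 ≤ a) : a ^ (1 - ν) * a ^ ν = a := by
  rw [← Real.rpow_add' ha (by simp), sub_add_cancel, Real.rpow_one]

theorem abs_rpow_sub_rpow_mul_rpow_le {a b ν : ℝ} (ha : 0 ≤ a) (hb : 0 ≤ b) (hν0 : 0 ≤ ν)
    (hν1 : ν ≤ 1) : |b ^ ν - a ^ ν| * a ^ (1 - ν) ≤ |b - a| := by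
  have haa : a ^ (1 - ν) * a ^ ν = a := rpow_one_sub_mul_rpow_self ha
  have hbb : b ^ (1 - ν) * b ^ ν = b := rpow_one_sub_mul_rpow_self hb
  have hbν : 0 ≤ b ^ ν := Real.rpow_nonneg hb ν
  rcases le_total a b with h | h
  · rw [abs_of_nonneg (sub_nonneg.2 h),
      abs_of_nonneg (sub_nonneg.2 (Real.rpow_le_rpow ha h hν0))]
    linarith [mul_le_mul_of_nonneg_right (Real.rpow_le_rpow ha h (sub_nonneg.2 hν1)) hbν]
  · rw [abs_of_nonpos (sub_nonpos.2 h),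
      abs_of_nonpos (sub_nonpos.2 (Real.rpow_le_rpow hb h hν0))]
    linarith [mul_le_mul_of_nonneg_right (Real.rpow_le_rpow hb h (sub_nonneg.2 hν1)) hbν]

/-- Estimate (3.5) of Lemma 3.1 for the function `f₀`: for all `ξ, η ∈ ℝⁿ`,
`|f₀(ξ) − f₀(η)| · |η|^{1−ν} ≤ |ξ − η|^{1−ν} · f₀(ξ − η) · f₀(η)`. -/
theorem stmt5 (n : ℕ) (hn : 1 ≤ n) (ν ρ : ℝ) (hν0 : 0 < ν) (hν1 : ν ≤ 1) (hρ : 0 < ρ)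
    (ξ η : EuclideanSpace ℝ (Fin n)) :
    |f0gev ν ρ ξ - f0gev ν ρ η| * ‖η‖ ^ (1 - ν) ≤
      ‖ξ - η‖ ^ (1 - ν) * f0gev ν ρ (ξ - η) * f0gev ν ρ η := by
  have hd : |‖ξ‖ - ‖η‖| ≤ ‖ξ - η‖ := abs_norm_sub_norm_le ξ η
  have hfac : |ρ * ‖ξ‖ ^ ν - ρ * ‖η‖ ^ ν| = ρ * |‖ξ‖ ^ ν - ‖η‖ ^ ν| := by
    rw [← mul_sub, abs_mul, abs_of_pos hρ]
  refine abs_exp_sub_exp_mul_le (by positivity) (by positivity) ?_ ?_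
  · rw [hfac]
    gcongr
    exact (abs_rpow_sub_rpow_le (norm_nonneg η) (norm_nonneg ξ) hν0.le hν1).trans
      (Real.rpow_le_rpow (abs_nonneg _) hd hν0.le)
  · rw [hfac, mul_assoc, mul_left_comm (‖ξ - η‖ ^ (1 - ν)),
      rpow_one_sub_mul_rpow_self (norm_nonneg (ξ - η))]
    gcongr
    exact (abs_rpow_sub_rpow_mul_rpow_le (norm_nonneg η) (norm_nonneg ξ) hν0.le hν1).trans hd
end

section
/- Let m ∈ ℝ and k₁, k₂ ∈ ℝ satisfy k₁ ≥ max(m, 0), k₂ ≥ max(m, 0), and k₁ + k₂ > m + n/2. Then there exists a constant C, depending only on n, m, k₁, k₂, such that for all measurable v₁, v₂ : ℝⁿ → ℂ one has (∫_{|ξ|>1} |ξ|^{2m} ((|v₁| ∗ |v₂|)(ξ))² dξ)^{1/2} ≤ C · ‖⟨·⟩^{k₁} v₁‖_{L²(ℝⁿ)} · ‖⟨·⟩^{k₂} v₂‖_{L²(ℝⁿ)}. (Estimate (3.14) of Lemma 3.2, stated in convolution form; via the Fourier transform it is the bound ‖|ξ|^m (u₁u₂)^∧ restricted to |ξ|>1‖₂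 ≤ C ‖⟨ξ⟩^{k₁} û₁‖₂ ‖⟨ξ⟩^{k₂} û₂‖₂.) -/
open MeasureTheory ENNReal

/-- The convolution of the absolute values of `v₁` and `v₂`, valued in `[0, ∞]`:
`(|v₁| ∗ |v₂|)(ξ) = ∫ |v₁(ξ − η)| |v₂(η)| dη`. -/
noncomputable def convAbs {n : ℕ} (v₁ v₂ : EuclideanSpace ℝ (Fin n) → ℂ)
    (ξ : EuclideanSpace ℝ (Fin n)) : ℝ≥0∞ :=
  ∫⁻ η, (‖v₁ (ξ - η)‖₊ : ℝ≥0∞) * (‖v₂ η‖₊ : ℝ≥0∞)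

/-- Cauchy–Schwarz inequality for the lower Lebesgue integral, in squared form. -/
theorem lintegral_mul_sq_le {α : Type*} [MeasurableSpace α] (μ : Measure α) {f g : α → ℝ≥0∞}
    (hf : AEMeasurable f μ) (hg : AEMeasurable g μ) :
    (∫⁻ x, f x * g x ∂μ) ^ 2 ≤ (∫⁻ x, f x ^ 2 ∂μ) * ∫⁻ x, g x ^ 2 ∂μ := by
  have h := ENNReal.lintegral_mul_le_Lp_mul_Lq μ Real.HolderConjugate.two_two hf hg
  simp only [Pi.mul_apply, ENNReal.rpow_two] at h
  rw [← ENNReal.mul_rpow_of_nonneg _ _ (by norm_num)] at h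
  calc (∫⁻ x, f x * g x ∂μ) ^ 2
      ≤ (((∫⁻ x, f x ^ 2 ∂μ) * ∫⁻ x, g x ^ 2 ∂μ) ^ ((1 : ℝ) / 2)) ^ 2 := by gcongr
    _ = _ := by
      rw [← ENNReal.rpow_two, ← ENNReal.rpow_mul]
      norm_num

/-- The sum of three squares controls the square of the sum. -/
theorem ENNReal.add_add_sq_le (a b c : ℝ≥0∞) :
    (a + b + c) ^ 2 ≤ 3 * (a ^ 2 + b ^ 2 + c ^ 2) := by
  rcases eq_or_ne a ∞ with rfl | ha
  · simp
  rcases eq_or_ne b ∞ with rfl | hb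
  · simp
  rcases eq_or_ne c ∞ with rfl | hc
  · simp
  lift a to NNReal using ha
  lift b to NNReal using hb
  lift c to NNReal using hc
  norm_cast
  rw [← NNReal.coe_le_coe]
  push_cast
  nlinarith [sq_nonneg ((a : ℝ) - b), sq_nonneg ((b : ℝ) - c), sq_nonneg ((a : ℝ) - c)]

section Convolution

variable {E : Type*} [AddCommGroup E] [MeasurableSpace E] [MeasurableAdd₂ E] [MeasurableNeg E]
  (μ : Measure E) [SFinite μ] [μ.IsAddLeftInvariant]

/-- The integral of a convolution is the product of the integrals. -/
theorem lintegral_lintegral_sub_mul {f g : E → ℝ≥0∞} (hf : Measurable f) (hg : Measurable g) :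
    ∫⁻ ξ, ∫⁻ η, f (ξ - η) * g η ∂μ ∂μ = (∫⁻ x, f x ∂μ) * ∫⁻ x, g x ∂μ := by
  rw [lintegral_lintegral_swap (by fun_prop)]
  have h : ∀ η, ∫⁻ ξ, f (ξ - η) * g η ∂μ = (∫⁻ x, f x ∂μ) * g η := fun η ↦ by
    rw [lintegral_mul_const _ (by fun_prop), lintegral_sub_right_eq_self]
  simp_rw [h]
  rw [lintegral_const_mul _ hg]

/-- An `L² × L² → L²` bound for convolution with a kernel dominated by the sum of an `L²` weight
evaluated at `ξ`, `ξ - η` and `η`. -/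
theorem lintegral_sq_lintegral_weight_le [μ.IsNegInvariant] {w f g : E → ℝ≥0∞} (hw : Measurable w)
    (hf : Measurable f) (hg : Measurable g) :
    ∫⁻ ξ, (∫⁻ η, (w ξ + w (ξ - η) + w η) * (f (ξ - η) * g η) ∂μ) ^ 2 ∂μ ≤
      9 * (∫⁻ x, w x ^ 2 ∂μ) * ((∫⁻ x, f x ^ 2 ∂μ) * ∫⁻ x, g x ^ 2 ∂μ) := by
  set W := ∫⁻ x, w x ^ 2 ∂μ
  set A := ∫⁻ x, f x ^ 2 ∂μ
  set B := ∫⁻ x, g x ^ 2 ∂μ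
  have hinv : ∀ (u : E → ℝ≥0∞) (ξ : E), ∫⁻ η, u (ξ - η) ∂μ = ∫⁻ η, u η ∂μ :=
    fun u ξ ↦ lintegral_sub_left_eq_self u ξ
  let P : E → ℝ≥0∞ := fun ξ ↦ ∫⁻ η, f (ξ - η) ^ 2 * g η ^ 2 ∂μ
  have hP : ∫⁻ ξ, P ξ ∂μ = A * B :=
    lintegral_lintegral_sub_mul μ (hf.pow_const 2) (hg.pow_const 2)
  have hPm : Measurable P := by
    apply Measurable.lintegral_prod_right'
      (f := fun p : E × E ↦ f (p.1 - p.2) ^ 2 * g p.2 ^ 2)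
    fun_prop
  have key : ∀ ξ, (∫⁻ η, (w ξ + w (ξ - η) + w η) * (f (ξ - η) * g η) ∂μ) ^ 2 ≤
      3 * (w ξ ^ 2 * (A * B) + W * P ξ + W * P ξ) := fun ξ ↦ by
    have h1 : (∫⁻ η, w ξ * (f (ξ - η) * g η) ∂μ) ^ 2 ≤ w ξ ^ 2 * (A * B) := by
      rw [lintegral_const_mul _ (by fun_prop), mul_pow]
      gcongr
      refine (lintegral_mul_sq_le μ (by fun_prop) (by fun_prop)).trans_eq ?_
      rw [hinv (fun x ↦ f x ^ 2)]
    have h2 : (∫⁻ η, w (ξ - η) * (f (ξ - η) * g η) ∂μ) ^ 2 ≤ W * P ξ := by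
      refine (lintegral_mul_sq_le μ (by fun_prop) (by fun_prop)).trans_eq ?_
      simp_rw [mul_pow]
      rw [hinv (fun x ↦ w x ^ 2)]
    have h3 : (∫⁻ η, w η * (f (ξ - η) * g η) ∂μ) ^ 2 ≤ W * P ξ := by
      refine (lintegral_mul_sq_le μ (by fun_prop) (by fun_prop)).trans_eq ?_
      simp_rw [mul_pow]
      rfl
    simp_rw [add_mul]
    rw [lintegral_add_left (by fun_prop), lintegral_add_left (by fun_prop)]
    refine (ENNReal.add_add_sq_le _ _ _).trans ?_
    gcongr
  refine (lintegral_mono key).trans_eq ?_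
  rw [lintegral_const_mul _ (by fun_prop), lintegral_add_left (by fun_prop),
    lintegral_add_left (by fun_prop), lintegral_mul_const _ (by fun_prop),
    lintegral_const_mul _ hPm, hP]
  change 3 * (W * (A * B) + W * (A * B) + W * (A * B)) = _
  ring

end Convolution

/-- If `p ≤ 4 q` and `r ≤ q`, a nonnegative power of `p` is absorbed by the larger factor `q`. -/
theorem rpow_le_mul_of_le {p q r m a b : ℝ} (hp : 0 < p) (hr : 0 < r) (hrq : r ≤ q)
    (hpq : p ≤ 4 * q) (hm : 0 ≤ m) (ha : m ≤ a) :
    p ^ m ≤ 4 ^ m * (r ^ (m - a - b) * (q ^ a * r ^ b)) := by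
  have hq : 0 < q := hr.trans_le hrq
  calc p ^ m ≤ (4 * q) ^ m := by gcongr
    _ = 4 ^ m * (q ^ (m - a) * q ^ a) := by
      rw [Real.mul_rpow (by norm_num) hq.le, ← Real.rpow_add hq]
      ring_nf
    _ ≤ 4 ^ m * (r ^ (m - a) * q ^ a) := by
      gcongr 4 ^ m * (?_ * q ^ a)
      exact Real.rpow_le_rpow_of_nonpos hr hrq (by linarith)
    _ = _ := by
      rw [show m - a = (m - a - b) + b by ring, Real.rpow_add hr]
      ring_nf

/-- A nonpositive power of `p` is controlled by the weight at the smaller factor `r`. -/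
theorem rpow_le_mul_of_nonpos {p q r m a b : ℝ} (hr : 0 < r) (hrq : r ≤ q)
    (hrp : r ≤ p) (hm : m ≤ 0) (ha : 0 ≤ a) :
    p ^ m ≤ r ^ (m - a - b) * (q ^ a * r ^ b) := by
  calc p ^ m ≤ r ^ m := Real.rpow_le_rpow_of_nonpos hr hrp hm
    _ = r ^ (m - a - b) * (r ^ a * r ^ b) := by
      rw [← Real.rpow_add hr, ← Real.rpow_add hr]
      ring_nf
    _ ≤ _ := by gcongr

/-- The kernel estimate behind the bilinear bound: up to a constant, `|ξ| ^ m` is dominated by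
the sum of the weights of total order `m - k₁ - k₂` at the three frequencies. -/
theorem rpow_le_sum_weights {x y z m k₁ k₂ : ℝ} (hx : 1 < x) (hy : 0 ≤ y) (hz : 0 ≤ z)
    (hxyz : x ≤ y + z) (hk₁ : max m 0 ≤ k₁) (hk₂ : max m 0 ≤ k₂) :
    x ^ m ≤ 4 ^ |m / 2| *
      (((1 + x ^ 2) ^ ((m - k₁ - k₂) / 2) + (1 + y ^ 2) ^ ((m - k₁ - k₂) / 2) +
        (1 + z ^ 2) ^ ((m - k₁ - k₂) / 2)) *
      ((1 + y ^ 2) ^ (k₁ / 2) * (1 + z ^ 2) ^ (k₂ / 2))) := by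
  obtain ⟨hm₁, h0₁⟩ := max_le_iff.1 hk₁
  obtain ⟨hm₂, h0₂⟩ := max_le_iff.1 hk₂
  have hxm : x ^ m = (x ^ 2) ^ (m / 2) := by
    rw [← Real.rpow_natCast x 2, ← Real.rpow_mul (by linarith)]
    norm_num
    ring_nf
  have hpqr : 1 + x ^ 2 ≤ 2 * (1 + y ^ 2) + 2 * (1 + z ^ 2) := by
    nlinarith [sq_nonneg (y - z)]
  have hpx : 1 + x ^ 2 ≤ 4 * x ^ 2 := by nlinarith
  have hs₁ : (m - k₁ - k₂) / 2 = m / 2 - k₁ / 2 - k₂ / 2 := by ring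
  have hs₂ : (m - k₁ - k₂) / 2 = m / 2 - k₂ / 2 - k₁ / 2 := by ring
  have hx2 : 0 < x ^ 2 := by positivity
  have hp : 0 < 1 + x ^ 2 := by positivity
  have hq : 0 < 1 + y ^ 2 := by positivity
  have hr : 0 < 1 + z ^ 2 := by positivity
  have hpp : x ^ 2 ≤ 1 + x ^ 2 := by linarith
  rw [hxm]
  clear hxm
  generalize 1 + x ^ 2 = p at *
  generalize x ^ 2 = t at *
  generalize 1 + y ^ 2 = q at *
  generalize 1 + z ^ 2 = r at *
  have hP := Real.rpow_nonneg hp.le ((m - k₁ - k₂) / 2)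
  have hQ := Real.rpow_nonneg hq.le ((m - k₁ - k₂) / 2)
  have hR := Real.rpow_nonneg hr.le ((m - k₁ - k₂) / 2)
  rcases le_or_gt 0 m with hm | hm
  · rw [abs_of_nonneg (by linarith)]
    have h1 : t ^ (m / 2) ≤ p ^ (m / 2) := by gcongr
    refine h1.trans ?_
    rcases le_total r q with h | h
    · refine (rpow_le_mul_of_le (a := k₁ / 2) (b := k₂ / 2) hp hr h (by linarith)
        (by linarith) (by linarith)).trans ?_
      rw [← hs₁]
      gcongr
      linarith
    · refine (rpow_le_mul_of_le (a := k₂ / 2) (b := k₁ / 2) hp hq h (by linarith)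
        (by linarith) (by linarith)).trans ?_
      rw [← hs₂, mul_comm (r ^ _)]
      gcongr
      linarith
  · rw [abs_of_neg (by linarith)]
    have h1 : t ^ (m / 2) ≤ 4 ^ (-(m / 2)) * p ^ (m / 2) := by
      calc t ^ (m / 2) = 4 ^ (-(m / 2)) * (4 * t) ^ (m / 2) := by
            rw [Real.mul_rpow (by norm_num) hx2.le, ← mul_assoc, ← Real.rpow_add (by norm_num)]
            simp
        _ ≤ _ := by
          gcongr 4 ^ (-(m / 2)) * ?_
          exact Real.rpow_le_rpow_of_nonpos hp hpx (by linarith)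
    refine h1.trans ?_
    gcongr 4 ^ (-(m / 2)) * ?_
    rcases le_total r q with h | h
    · rcases le_total r p with h' | h'
      · refine (rpow_le_mul_of_nonpos (a := k₁ / 2) (b := k₂ / 2) hr h h' (by linarith)
          (by linarith)).trans ?_
        rw [← hs₁]
        gcongr
        linarith
      · refine (rpow_le_mul_of_nonpos (q := q) (a := k₁ / 2) (b := k₂ / 2) hp (h'.trans h) le_rfl
          (by linarith) (by linarith)).trans ?_
        rw [← hs₁]
        gcongr
        linarith
    · rcases le_total q p with h' | h'
      · refine (rpow_le_mul_of_nonpos (a := k₂ / 2) (b := k₁ / 2) hq h h' (by linarith)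
          (by linarith)).trans ?_
        rw [← hs₂, mul_comm (r ^ _)]
        gcongr
        linarith
      · refine (rpow_le_mul_of_nonpos (q := r) (a := k₂ / 2) (b := k₁ / 2) hp (h'.trans h) le_rfl
          (by linarith) (by linarith)).trans ?_
        rw [← hs₂, mul_comm (r ^ _)]
        gcongr
        linarith

/-- Squaring a half-power inside `ENNReal.ofReal`. -/
theorem ofReal_rpow_half_sq {t : ℝ} (ht : 0 ≤ t) (a : ℝ) :
    ENNReal.ofReal (t ^ (a / 2)) ^ 2 = ENNReal.ofReal (t ^ a) := by
  rw [← ENNReal.ofReal_pow (by positivity), ← Real.rpow_natCast, ← Real.rpow_mul ht]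
  norm_num

/-- Estimate (3.14) of Lemma 3.2, in convolution form: if `k₁, k₂ ≥ max(m,0)` and
`k₁ + k₂ > m + n/2`, then there is a constant `C = C(n, m, k₁, k₂)` such that
`(∫_{|ξ|>1} |ξ|^{2m} ((|v₁| ∗ |v₂|)(ξ))² dξ)^{1/2}
  ≤ C ‖⟨·⟩^{k₁} v₁‖_{L²} ‖⟨·⟩^{k₂} v₂‖_{L²}`. -/
theorem stmt6 (n : ℕ) (hn : 1 ≤ n) (m k₁ k₂ : ℝ)
    (hk₁ : max m 0 ≤ k₁) (hk₂ : max m 0 ≤ k₂) (hsum : m + (n : ℝ) / 2 < k₁ + k₂) :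
    ∃ C : ℝ, 0 ≤ C ∧ ∀ v₁ v₂ : EuclideanSpace ℝ (Fin n) → ℂ,
      Measurable v₁ → Measurable v₂ →
      (∫⁻ ξ in {ξ : EuclideanSpace ℝ (Fin n) | 1 < ‖ξ‖},
          ENNReal.ofReal (‖ξ‖ ^ (2 * m)) * convAbs v₁ v₂ ξ ^ 2) ^ ((1 : ℝ) / 2) ≤
        ENNReal.ofReal C *
          (∫⁻ ξ, ENNReal.ofReal ((1 + ‖ξ‖ ^ 2) ^ k₁) * (‖v₁ ξ‖₊ : ℝ≥0∞) ^ 2) ^ ((1 : ℝ) / 2) *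
          (∫⁻ ξ, ENNReal.ofReal ((1 + ‖ξ‖ ^ 2) ^ k₂) * (‖v₂ ξ‖₊ : ℝ≥0∞) ^ 2) ^ ((1 : ℝ) / 2) := by
  let E := EuclideanSpace ℝ (Fin n)
  let w : E → ℝ≥0∞ := fun x ↦ ENNReal.ofReal ((1 + ‖x‖ ^ 2) ^ ((m - k₁ - k₂) / 2))
  have hw : Measurable w := by fun_prop
  have hWfin : ∫⁻ x, w x ^ 2 < ∞ := by
    have h := integrable_rpow_neg_one_add_norm_sq (E := E) (μ := volume)
      (r := 2 * (k₁ + k₂ - m)) (by simp [E]; linarith)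
    have h' := h.lintegral_lt_top
    refine lt_of_eq_of_lt (lintegral_congr fun x ↦ ?_) h'
    simp only [w]
    rw [ofReal_rpow_half_sq (by positivity)]
    ring_nf
  set c : ℝ := 4 ^ |m / 2| with hc
  set D : ℝ≥0∞ := ENNReal.ofReal c ^ 2 * (9 * ∫⁻ x, w x ^ 2) with hD
  have hDfin : D ≠ ∞ := by
    refine ENNReal.mul_ne_top (by simp) (ENNReal.mul_ne_top (by simp) hWfin.ne)
  refine ⟨D.toReal ^ ((1 : ℝ) / 2), by positivity, fun v₁ v₂ hv₁ hv₂ ↦ ?_⟩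
  rw [← ENNReal.ofReal_rpow_of_nonneg ENNReal.toReal_nonneg (by norm_num),
    ENNReal.ofReal_toReal hDfin, ← ENNReal.mul_rpow_of_nonneg _ _ (by norm_num),
    ← ENNReal.mul_rpow_of_nonneg _ _ (by norm_num)]
  gcongr
  let F (k : ℝ) (v : E → ℂ) : E → ℝ≥0∞ :=
    fun x ↦ ENNReal.ofReal ((1 + ‖x‖ ^ 2) ^ (k / 2)) * (‖v x‖₊ : ℝ≥0∞)
  have hF : ∀ k {v : E → ℂ}, Measurable v → Measurable (F k v) := fun k v hv ↦ by fun_prop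
  have hFsq : ∀ k (v : E → ℂ), ∫⁻ x, F k v x ^ 2 =
      ∫⁻ x, ENNReal.ofReal ((1 + ‖x‖ ^ 2) ^ k) * (‖v x‖₊ : ℝ≥0∞) ^ 2 := fun k v ↦ by
    refine lintegral_congr fun x ↦ ?_
    simp only [F]
    rw [mul_pow, ofReal_rpow_half_sq (by positivity)]
  have hpt : ∀ ξ ∈ {ξ : E | 1 < ‖ξ‖},
      ENNReal.ofReal (‖ξ‖ ^ (2 * m)) * convAbs v₁ v₂ ξ ^ 2 ≤ ENNReal.ofReal c ^ 2 *
        (∫⁻ η, (w ξ + w (ξ - η) + w η) * (F k₁ v₁ (ξ - η) * F k₂ v₂ η)) ^ 2 := fun ξ hξ ↦ by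
    have h1 : ENNReal.ofReal (‖ξ‖ ^ (2 * m)) = ENNReal.ofReal (‖ξ‖ ^ m) ^ 2 := by
      rw [← ofReal_rpow_half_sq (norm_nonneg ξ)]
      ring_nf
    rw [h1, ← mul_pow, ← mul_pow, convAbs, ← lintegral_const_mul' _ _ ofReal_ne_top,
      ← lintegral_const_mul' _ _ ofReal_ne_top]
    refine pow_le_pow_left₀ zero_le (lintegral_mono fun η ↦ ?_) 2
    have h := ENNReal.ofReal_le_ofReal <| rpow_le_sum_weights (m := m) hξ
      (norm_nonneg (ξ - η)) (norm_nonneg η)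
      (by simpa using norm_add_le (ξ - η) η) hk₁ hk₂
    rw [← hc, ENNReal.ofReal_mul (by positivity), ENNReal.ofReal_mul (by positivity),
      ENNReal.ofReal_mul (by positivity), ENNReal.ofReal_add (by positivity) (by positivity),
      ENNReal.ofReal_add (by positivity) (by positivity)] at h
    refine (mul_le_mul_left h _).trans_eq ?_
    simp only [w, F]
    ring
  calc _ ≤ ∫⁻ ξ in {ξ : E | 1 < ‖ξ‖}, ENNReal.ofReal c ^ 2 *
        (∫⁻ η, (w ξ + w (ξ - η) + w η) * (F k₁ v₁ (ξ - η) * F k₂ v₂ η)) ^ 2 :=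
        setLIntegral_mono' (measurableSet_lt (by fun_prop) (by fun_prop)) hpt
    _ ≤ ∫⁻ ξ, ENNReal.ofReal c ^ 2 *
        (∫⁻ η, (w ξ + w (ξ - η) + w η) * (F k₁ v₁ (ξ - η) * F k₂ v₂ η)) ^ 2 :=
        setLIntegral_le_lintegral _ _
    _ ≤ ENNReal.ofReal c ^ 2 * (9 * (∫⁻ x, w x ^ 2) *
        ((∫⁻ x, F k₁ v₁ x ^ 2) * ∫⁻ x, F k₂ v₂ x ^ 2)) := by
      rw [lintegral_const_mul' _ _ (by simp)]
      gcongr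
      exact lintegral_sq_lintegral_weight_le volume hw (hF k₁ hv₁) (hF k₂ hv₂)
    _ = _ := by
      rw [hFsq, hFsq, hD]
      ring
end

section
/- For every integer m ≥ 0 and every t ≥ 1 one has ∫_t^∞ t₁^{−2} N_m(t₁) dt₁ = Q_m(t). (Identity (3.75) of Lemma 3.8.) -/
open MeasureTheory

/-- `h(t) = ∫₁^∞ max(t, t₁)⁻¹ h₀′(t₁) dt₁`. -/
noncomputable def hFun (h₀' : ℝ → ℝ) (t : ℝ) : ℝ :=
  ∫ t₁ in Set.Ici (1 : ℝ), (max t t₁)⁻¹ * h₀' t₁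

/-- `N_m(t) = ∫₁^t h₀′(t₁) h(t₁)^m dt₁`. -/
noncomputable def NFun (h₀' : ℝ → ℝ) (m : ℕ) (t : ℝ) : ℝ :=
  ∫ t₁ in (1 : ℝ)..t, h₀' t₁ * hFun h₀' t₁ ^ m

/-- `Q_m(t) = ∫₁^∞ max(t, t₁)⁻¹ h₀′(t₁) h(t₁)^m dt₁`. -/
noncomputable def QFun (h₀' : ℝ → ℝ) (m : ℕ) (t : ℝ) : ℝ :=
  ∫ t₁ in Set.Ici (1 : ℝ), (max t t₁)⁻¹ * h₀' t₁ * hFun h₀' t₁ ^ m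

theorem integrableOn_and_integral_Ioi_sq_inv {a : ℝ} (ha : 0 < a) :
    IntegrableOn (fun u : ℝ => (u ^ 2)⁻¹) (Set.Ioi a) ∧
      ∫ u in Set.Ioi a, (u ^ 2)⁻¹ = a⁻¹ := by
  have heq : Set.EqOn (fun u : ℝ => u ^ (-2 : ℝ)) (fun u => (u ^ 2)⁻¹) (Set.Ioi a) := by
    intro u hu
    have hu0 : 0 < u := ha.trans hu
    simp only [Real.rpow_neg hu0.le]
    norm_cast
  refine ⟨(integrableOn_Ioi_rpow_of_lt (by norm_num) ha).congr_fun heq measurableSet_Ioi, ?_⟩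
  rw [← setIntegral_congr_fun measurableSet_Ioi heq,
    integral_Ioi_rpow_of_lt (by norm_num) ha]
  norm_num [Real.rpow_neg_one]

/-- Swapping the order of integration in `∫_t^∞ u⁻² ∫_1^u g(s) ds du`. -/
theorem integral_Ici_sq_inv_mul_integral {g : ℝ → ℝ}
    (hg : AEStronglyMeasurable g (volume.restrict (Set.Ioi 1)))
    (hint : IntegrableOn (fun s => s⁻¹ * g s) (Set.Ioi 1)) {t : ℝ} (ht : 1 ≤ t) :
    ∫ u in Set.Ici t, (u ^ 2)⁻¹ * ∫ s in (1 : ℝ)..u, g s =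
      ∫ s in Set.Ici (1 : ℝ), (max t s)⁻¹ * g s := by
  set F : ℝ × ℝ → ℝ :=
    {p : ℝ × ℝ | p.2 < p.1}.indicator (fun p => (p.1 ^ 2)⁻¹ * g p.2) with hF
  have hslice : ∀ s : ℝ, (fun u => F (u, s)) =
      (Set.Ioi s).indicator (fun u => (u ^ 2)⁻¹ * g s) := by
    intro s
    ext u
    simp [hF, Set.indicator_apply]
  have hslice' : ∀ u : ℝ, (fun s => F (u, s)) =
      (Set.Iio u).indicator (fun s => (u ^ 2)⁻¹ * g s) := by
    intro u
    ext s
    simp [hF, Set.indicator_apply]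
  have hpos : ∀ s : ℝ, 0 < max s t := fun s => by
    have := le_max_right s t
    linarith
  have hinner : ∀ s : ℝ, ∫ u in Set.Ioi t, F (u, s) = (max t s)⁻¹ * g s := by
    intro s
    rw [hslice, setIntegral_indicator measurableSet_Ioi, Set.inter_comm, Set.Ioi_inter_Ioi,
      integral_mul_const, (integrableOn_and_integral_Ioi_sq_inv (hpos s)).2, max_comm]
  have hinner_norm : ∀ s : ℝ, ∫ u in Set.Ioi t, ‖F (u, s)‖ = (max t s)⁻¹ * ‖g s‖ := by
    intro s
    have : (fun u => ‖F (u, s)‖) = (Set.Ioi s).indicator (fun u => (u ^ 2)⁻¹ * ‖g s‖) := by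
      ext u
      rw [congrFun (hslice s) u, norm_indicator_eq_indicator_norm]
      simp
    rw [this, setIntegral_indicator measurableSet_Ioi, Set.inter_comm, Set.Ioi_inter_Ioi,
      integral_mul_const, (integrableOn_and_integral_Ioi_sq_inv (hpos s)).2, max_comm]
  have hmeas : AEStronglyMeasurable F
      ((volume.restrict (Set.Ioi t)).prod (volume.restrict (Set.Ioi 1))) := by
    refine AEStronglyMeasurable.indicator ?_ (measurableSet_lt measurable_snd measurable_fst)
    refine AEStronglyMeasurable.mul ?_ hg.comp_snd
    exact (by fun_prop : Measurable fun p : ℝ × ℝ => (p.1 ^ 2)⁻¹).aestronglyMeasurable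
  have hintF : Integrable F
      ((volume.restrict (Set.Ioi t)).prod (volume.restrict (Set.Ioi 1))) := by
    rw [integrable_prod_iff' hmeas]
    constructor
    · refine Filter.Eventually.of_forall fun s => ?_
      rw [hslice, integrable_indicator_iff measurableSet_Ioi, IntegrableOn,
        Measure.restrict_restrict measurableSet_Ioi, Set.Ioi_inter_Ioi]
      exact (integrableOn_and_integral_Ioi_sq_inv (hpos s)).1.mul_const _
    · simp only [hinner_norm]
      refine Integrable.mono' hint.norm ?_ ?_
      · refine AEStronglyMeasurable.mul ?_ hg.norm
        exact (by fun_prop : Measurable fun s : ℝ => (max t s)⁻¹).aestronglyMeasurable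
      · refine (ae_restrict_mem measurableSet_Ioi).mono fun s hs => ?_
        have hs0 : 0 < s := one_pos.trans hs
        rw [norm_mul, norm_mul, norm_norm, Real.norm_of_nonneg (inv_nonneg.2 hs0.le),
          Real.norm_of_nonneg (inv_nonneg.2 (hs0.le.trans (le_max_right t s)))]
        gcongr
        exact le_max_right t s
  have hswap := integral_integral_swap (f := fun u s => F (u, s)) hintF
  simp only [hinner] at hswap
  rw [integral_Ici_eq_integral_Ioi, integral_Ici_eq_integral_Ioi, ← hswap]
  refine setIntegral_congr_fun measurableSet_Ioi fun u hu => ?_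
  have hu1 : 1 ≤ u := ht.trans (le_of_lt hu)
  rw [hslice', setIntegral_indicator measurableSet_Iio, Set.Ioi_inter_Iio, integral_const_mul,
    intervalIntegral.integral_of_le hu1, integral_Ioc_eq_integral_Ioo]

section hFun

variable {f : ℝ → ℝ}

theorem max_inv_mul_le (hf : ∀ t ∈ Set.Ici (1 : ℝ), 0 ≤ f t) (t : ℝ) {s : ℝ}
    (hs : s ∈ Set.Ici (1 : ℝ)) : (max t s)⁻¹ * f s ≤ s⁻¹ * f s := by
  have hs0 : 0 < s := one_pos.trans_le hs
  have := hf s hs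
  gcongr
  exact le_max_right t s

theorem max_inv_mul_nonneg (hf : ∀ t ∈ Set.Ici (1 : ℝ), 0 ≤ f t) (t : ℝ) {s : ℝ}
    (hs : s ∈ Set.Ici (1 : ℝ)) : 0 ≤ (max t s)⁻¹ * f s :=
  mul_nonneg (inv_nonneg.2 ((zero_le_one.trans hs).trans (le_max_right t s))) (hf s hs)

theorem integrableOn_max_inv_mul (hcont : ContinuousOn f (Set.Ici 1))
    (hf : ∀ t ∈ Set.Ici (1 : ℝ), 0 ≤ f t)
    (hint : IntegrableOn (fun t => t⁻¹ * f t) (Set.Ici 1)) (t : ℝ) :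
    IntegrableOn (fun s => (max t s)⁻¹ * f s) (Set.Ici 1) := by
  refine Integrable.mono' hint ?_ ?_
  · refine AEStronglyMeasurable.mul ?_ (hcont.aestronglyMeasurable measurableSet_Ici)
    exact (by fun_prop : Measurable fun s : ℝ => (max t s)⁻¹).aestronglyMeasurable
  · refine (ae_restrict_mem measurableSet_Ici).mono fun s hs => ?_
    rw [Real.norm_of_nonneg (max_inv_mul_nonneg hf t hs)]
    exact max_inv_mul_le hf t hs

theorem hFun_nonneg (hf : ∀ t ∈ Set.Ici (1 : ℝ), 0 ≤ f t) (t : ℝ) : 0 ≤ hFun f t :=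
  setIntegral_nonneg measurableSet_Ici fun _ hs => max_inv_mul_nonneg hf t hs

theorem hFun_le (hcont : ContinuousOn f (Set.Ici 1)) (hf : ∀ t ∈ Set.Ici (1 : ℝ), 0 ≤ f t)
    (hint : IntegrableOn (fun t => t⁻¹ * f t) (Set.Ici 1)) (t : ℝ) :
    hFun f t ≤ ∫ s in Set.Ici (1 : ℝ), s⁻¹ * f s :=
  setIntegral_mono_on (integrableOn_max_inv_mul hcont hf hint t) hint measurableSet_Ici
    fun _ hs => max_inv_mul_le hf t hs

theorem hFun_antitone (hcont : ContinuousOn f (Set.Ici 1))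
    (hf : ∀ t ∈ Set.Ici (1 : ℝ), 0 ≤ f t)
    (hint : IntegrableOn (fun t => t⁻¹ * f t) (Set.Ici 1)) : Antitone (hFun f) := by
  intro a b hab
  refine setIntegral_mono_on (integrableOn_max_inv_mul hcont hf hint b)
    (integrableOn_max_inv_mul hcont hf hint a) measurableSet_Ici fun s hs => ?_
  have hs0 : 0 < s := one_pos.trans_le hs
  have := hf s hs
  gcongr

end hFun

/-- Identity (3.75) of Lemma 3.8: `∫_t^∞ t₁⁻² N_m(t₁) dt₁ = Q_m(t)` for `m ≥ 0`, `t ≥ 1`. -/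
theorem stmt11 (h₀ h₀' : ℝ → ℝ)
    (hderiv : ∀ t ∈ Set.Ici (1 : ℝ), HasDerivWithinAt h₀ (h₀' t) (Set.Ici 1) t)
    (hcont : ContinuousOn h₀' (Set.Ici 1))
    (h₀nonneg : ∀ t ∈ Set.Ici (1 : ℝ), 0 ≤ h₀ t)
    (h₀'nonneg : ∀ t ∈ Set.Ici (1 : ℝ), 0 ≤ h₀' t)
    (hint₀ : IntegrableOn (fun t => (t ^ 2)⁻¹ * h₀ t) (Set.Ici 1))
    (hint' : IntegrableOn (fun t => t⁻¹ * h₀' t) (Set.Ici 1))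
    (m : ℕ) (t : ℝ) (ht : 1 ≤ t) :
    ∫ t₁ in Set.Ici t, (t₁ ^ 2)⁻¹ * NFun h₀' m t₁ = QFun h₀' m t := by
  have hmeas : Measurable fun s => hFun h₀' s ^ m :=
    (hFun_antitone hcont h₀'nonneg hint').measurable.pow_const m
  unfold NFun QFun
  simp only [mul_assoc]
  refine integral_Ici_sq_inv_mul_integral ?_ ?_ ht
  · refine AEStronglyMeasurable.mul ?_ hmeas.aestronglyMeasurable
    exact (hcont.mono Set.Ioi_subset_Ici_self).aestronglyMeasurable measurableSet_Ioi
  · simp only [← mul_assoc]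
    refine (hint'.mono_set Set.Ioi_subset_Ici_self).mul_bdd
      (c := (∫ s in Set.Ici (1 : ℝ), s⁻¹ * h₀' s) ^ m) hmeas.aestronglyMeasurable
      (Filter.Eventually.of_forall fun s => ?_)
    have hnonneg := hFun_nonneg h₀'nonneg s
    rw [Real.norm_of_nonneg (pow_nonneg hnonneg m)]
    exact pow_le_pow_left₀ hnonneg (hFun_le hcont h₀'nonneg hint' s) m
end

section
/- Let 0 < ν ≤ 1 and x ≥ 0. Then Σ_{j≥1} j (j!)^{−1/ν} x^j ≤ x^ν · Σ_{j≥0} (j!)^{−1/ν} x^j ≤ Σ_{j≥0} (j+1) (j!)^{−1/ν} x^j, and Σ_{j≥0} (j+1)^{−1} (j!)^{−1/ν} x^{j+1} ≤ x^{1−ν} · Σ_{j≥0} (j!)^{−1/ν} x^j. (Estimates (A.3) and (A.4) of Lemma A.1.) -/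
/-- The Gevrey generating function `f̃(x) = Σ_{j≥0} (j!)^{−1/ν} x^j`. -/
noncomputable def ftilde (ν x : ℝ) : ℝ :=
  ∑' j : ℕ, (j.factorial : ℝ) ^ (-(1 / ν)) * x ^ j

/-- `F(x) = Σ_{j≥0} (j+1)^{−1} (j!)^{−1/ν} x^{j+1}`. -/
noncomputable def Fgev (ν x : ℝ) : ℝ :=
  ∑' j : ℕ, ((j : ℝ) + 1)⁻¹ * (j.factorial : ℝ) ^ (-(1 / ν)) * x ^ (j + 1)

/-- The general term `(j!)^{−1/ν} x^j` of the Gevrey generating function. -/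
noncomputable def gevreyTerm (ν x : ℝ) (j : ℕ) : ℝ :=
  (j.factorial : ℝ) ^ (-(1 / ν)) * x ^ j

theorem gevreyTerm_nonneg (ν : ℝ) {x : ℝ} (hx : 0 ≤ x) (j : ℕ) : 0 ≤ gevreyTerm ν x j := by
  unfold gevreyTerm
  positivity

theorem gevreyTerm_le {ν x : ℝ} (hν0 : 0 < ν) (hν1 : ν ≤ 1) (hx : 0 ≤ x) (j : ℕ) :
    gevreyTerm ν x j ≤ x ^ j / j.factorial := by
  have h1 : (1 : ℝ) ≤ j.factorial := by exact_mod_cast j.factorial_pos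
  have h2 : (j.factorial : ℝ) ^ (-(1 / ν)) ≤ (j.factorial : ℝ) ^ (-1 : ℝ) :=
    Real.rpow_le_rpow_of_exponent_le h1 (neg_le_neg ((one_le_div hν0).2 hν1))
  rw [Real.rpow_neg_one] at h2
  rw [div_eq_inv_mul]
  exact mul_le_mul_of_nonneg_right h2 (pow_nonneg hx j)

theorem summable_gevreyTerm {ν x : ℝ} (hν0 : 0 < ν) (hν1 : ν ≤ 1) (hx : 0 ≤ x) :
    Summable (gevreyTerm ν x) :=
  (Real.summable_pow_div_factorial x).of_nonneg_of_le (gevreyTerm_nonneg ν hx)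
    (gevreyTerm_le hν0 hν1 hx)

theorem summable_natCast_mul_gevreyTerm {ν x : ℝ} (hν0 : 0 < ν) (hν1 : ν ≤ 1) (hx : 0 ≤ x) :
    Summable fun j : ℕ => (j : ℝ) * gevreyTerm ν x j := by
  refine (Real.summable_pow_div_factorial (2 * x)).of_nonneg_of_le
    (fun j => mul_nonneg j.cast_nonneg (gevreyTerm_nonneg ν hx j)) fun j => ?_
  have h : (j : ℝ) ≤ 2 ^ j := by exact_mod_cast Nat.lt_two_pow_self.le
  rw [mul_pow, mul_div_assoc]
  exact mul_le_mul h (gevreyTerm_le hν0 hν1 hx j) (gevreyTerm_nonneg ν hx j) (by positivity)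

theorem rpow_mul_gevreyTerm_rpow {ν x : ℝ} (hν0 : 0 < ν) (hx : 0 ≤ x) (j : ℕ) :
    x ^ ν * gevreyTerm ν x j ^ ν = ((j : ℝ) + 1) * gevreyTerm ν x (j + 1) ^ ν := by
  have hpow (n : ℕ) : gevreyTerm ν x n ^ ν = (n.factorial : ℝ)⁻¹ * (x ^ n) ^ ν := by
    rw [gevreyTerm, Real.mul_rpow (by positivity) (by positivity),
      ← Real.rpow_mul (by positivity), neg_mul, one_div_mul_cancel hν0.ne', Real.rpow_neg_one]
  rw [hpow, hpow, pow_succ, Real.mul_rpow (by positivity) hx, Nat.factorial_succ]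
  push_cast
  field_simp

theorem rpow_mul_rpow_one_sub_self {ν p : ℝ} (hν0 : 0 < ν) (hν1 : ν ≤ 1) (hp : 0 ≤ p) :
    p ^ ν * p ^ (1 - ν) = p := by
  rw [← Real.rpow_add_of_nonneg hp hν0.le (sub_nonneg.2 hν1), add_sub_cancel, Real.rpow_one]

theorem rpow_mul_rpow_one_sub_le {ν p q : ℝ} (hν0 : 0 < ν) (hν1 : ν ≤ 1) (hp : 0 ≤ p)
    (hq : 0 ≤ q) : p ^ ν * q ^ (1 - ν) ≤ ν * p + (1 - ν) * q :=
  Real.geom_mean_le_arith_mean2_weighted hν0.le (sub_nonneg.2 hν1) hp hq (by ring)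

theorem succ_mul_gevreyTerm_succ_le {ν x : ℝ} (hν0 : 0 < ν) (hν1 : ν ≤ 1) (hx : 0 ≤ x) (j : ℕ) :
    ((j : ℝ) + 1) * gevreyTerm ν x (j + 1) ≤
      x ^ ν * (ν * gevreyTerm ν x j + (1 - ν) * gevreyTerm ν x (j + 1)) := by
  have ha := gevreyTerm_nonneg ν hx
  calc ((j : ℝ) + 1) * gevreyTerm ν x (j + 1)
      = x ^ ν * (gevreyTerm ν x j ^ ν * gevreyTerm ν x (j + 1) ^ (1 - ν)) := by
        rw [← mul_assoc, rpow_mul_gevreyTerm_rpow hν0 hx, mul_assoc,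
          rpow_mul_rpow_one_sub_self hν0 hν1 (ha _)]
    _ ≤ _ := mul_le_mul_of_nonneg_left (rpow_mul_rpow_one_sub_le hν0 hν1 (ha _) (ha _))
        (Real.rpow_nonneg hx ν)

theorem rpow_mul_gevreyTerm_le {ν x : ℝ} (hν0 : 0 < ν) (hν1 : ν ≤ 1) (hx : 0 ≤ x) (j : ℕ) :
    x ^ ν * gevreyTerm ν x j ≤
      ((j : ℝ) + 1) * (ν * gevreyTerm ν x (j + 1) + (1 - ν) * gevreyTerm ν x j) := by
  have ha := gevreyTerm_nonneg ν hx
  calc x ^ ν * gevreyTerm ν x j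
      = ((j : ℝ) + 1) * (gevreyTerm ν x (j + 1) ^ ν * gevreyTerm ν x j ^ (1 - ν)) := by
        rw [← mul_assoc, ← rpow_mul_gevreyTerm_rpow hν0 hx, mul_assoc,
          rpow_mul_rpow_one_sub_self hν0 hν1 (ha _)]
    _ ≤ _ := mul_le_mul_of_nonneg_left (rpow_mul_rpow_one_sub_le hν0 hν1 (ha _) (ha _))
        (by positivity)

theorem inv_succ_mul_gevreyTerm_le {ν x : ℝ} (hν0 : 0 < ν) (hν1 : ν ≤ 1) (hx : 0 ≤ x) (j : ℕ) :
    ((j : ℝ) + 1)⁻¹ * (x * gevreyTerm ν x j) ≤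
      x ^ (1 - ν) * (ν * gevreyTerm ν x (j + 1) + (1 - ν) * gevreyTerm ν x j) := by
  have hj : (0 : ℝ) < (j : ℝ) + 1 := by positivity
  rw [inv_mul_le_iff₀ hj]
  calc x * gevreyTerm ν x j
      = x ^ (1 - ν) * (x ^ ν * gevreyTerm ν x j) := by
        rw [← mul_assoc, mul_comm (x ^ (1 - ν)), rpow_mul_rpow_one_sub_self hν0 hν1 hx]
    _ ≤ _ := mul_le_mul_of_nonneg_left (rpow_mul_gevreyTerm_le hν0 hν1 hx j)
        (Real.rpow_nonneg hx _)
    _ = _ := by ring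

/-- Estimates (A.3) and (A.4) of Lemma A.1: for `0 < ν ≤ 1` and `x ≥ 0`,
`Σ_{j≥1} j (j!)^{−1/ν} x^j ≤ x^ν Σ_{j≥0} (j!)^{−1/ν} x^j ≤ Σ_{j≥0} (j+1)(j!)^{−1/ν} x^j`
and `Σ_{j≥0} (j+1)^{−1} (j!)^{−1/ν} x^{j+1} ≤ x^{1−ν} Σ_{j≥0} (j!)^{−1/ν} x^j`. -/
theorem stmt16 (ν : ℝ) (hν0 : 0 < ν) (hν1 : ν ≤ 1) (x : ℝ) (hx : 0 ≤ x) :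
    (∑' j : ℕ, (j : ℝ) * (j.factorial : ℝ) ^ (-(1 / ν)) * x ^ j ≤ x ^ ν * ftilde ν x) ∧
    (x ^ ν * ftilde ν x ≤ ∑' j : ℕ, ((j : ℝ) + 1) * (j.factorial : ℝ) ^ (-(1 / ν)) * x ^ j) ∧
    (Fgev ν x ≤ x ^ (1 - ν) * ftilde ν x) := by
  have hs := summable_gevreyTerm hν0 hν1 hx
  have hsj := summable_natCast_mul_gevreyTerm hν0 hν1 hx
  have hs' := (summable_nat_add_iff 1).2 hs
  have hsj' : Summable fun j : ℕ => ((j : ℝ) + 1) * gevreyTerm ν x (j + 1) := by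
    simpa using (summable_nat_add_iff 1).2 hsj
  have hsj1 : Summable fun j : ℕ => ((j : ℝ) + 1) * gevreyTerm ν x j := by
    simpa only [add_one_mul] using hsj.add hs
  have hf : ftilde ν x = ∑' j, gevreyTerm ν x j := rfl
  have htail : ∑' j, gevreyTerm ν x (j + 1) ≤ ∑' j, gevreyTerm ν x j := by
    rw [hs.tsum_eq_zero_add]
    exact le_add_of_nonneg_left (gevreyTerm_nonneg ν hx 0)
  have htailj : ∑' j : ℕ, (j : ℝ) * gevreyTerm ν x j =
      ∑' j : ℕ, ((j : ℝ) + 1) * gevreyTerm ν x (j + 1) := by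
    simp [hsj.tsum_eq_zero_add]
  have hν1' : 0 ≤ 1 - ν := sub_nonneg.2 hν1
  refine ⟨?_, ?_, ?_⟩
  · calc ∑' j : ℕ, (j : ℝ) * (j.factorial : ℝ) ^ (-(1 / ν)) * x ^ j
        = ∑' j : ℕ, ((j : ℝ) + 1) * gevreyTerm ν x (j + 1) := by
          rw [← htailj]
          simp only [gevreyTerm, mul_assoc]
      _ ≤ ∑' j, x ^ ν * (ν * gevreyTerm ν x j + (1 - ν) * gevreyTerm ν x (j + 1)) :=
          hsj'.tsum_le_tsum (succ_mul_gevreyTerm_succ_le hν0 hν1 hx)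
            (((hs.mul_left _).add (hs'.mul_left _)).mul_left _)
      _ = x ^ ν * (ν * ∑' j, gevreyTerm ν x j + (1 - ν) * ∑' j, gevreyTerm ν x (j + 1)) := by
          rw [tsum_mul_left, (hs.mul_left _).tsum_add (hs'.mul_left _), tsum_mul_left,
            tsum_mul_left]
      _ ≤ x ^ ν * ftilde ν x := by
          rw [hf]
          refine mul_le_mul_of_nonneg_left ?_ (Real.rpow_nonneg hx ν)
          linarith [mul_le_mul_of_nonneg_left htail hν1']
  · have hle : ∑' j : ℕ, (j : ℝ) * gevreyTerm ν x j ≤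
        ∑' j : ℕ, ((j : ℝ) + 1) * gevreyTerm ν x j :=
      hsj.tsum_le_tsum (fun j => mul_le_mul_of_nonneg_right (by linarith)
        (gevreyTerm_nonneg ν hx j)) hsj1
    calc x ^ ν * ftilde ν x = ∑' j, x ^ ν * gevreyTerm ν x j := by rw [hf, tsum_mul_left]
      _ ≤ ∑' j : ℕ, (ν * (((j : ℝ) + 1) * gevreyTerm ν x (j + 1)) +
            (1 - ν) * (((j : ℝ) + 1) * gevreyTerm ν x j)) :=
          (hs.mul_left _).tsum_le_tsum
            (fun j => (rpow_mul_gevreyTerm_le hν0 hν1 hx j).trans_eq (by ring))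
            ((hsj'.mul_left _).add (hsj1.mul_left _))
      _ = ν * ∑' j : ℕ, (j : ℝ) * gevreyTerm ν x j +
            (1 - ν) * ∑' j : ℕ, ((j : ℝ) + 1) * gevreyTerm ν x j := by
          rw [(hsj'.mul_left _).tsum_add (hsj1.mul_left _), tsum_mul_left, tsum_mul_left, htailj]
      _ ≤ ∑' j : ℕ, ((j : ℝ) + 1) * gevreyTerm ν x j := by
          linarith [mul_le_mul_of_nonneg_left hle hν0.le]
      _ = _ := by simp only [gevreyTerm, mul_assoc]
  · have hbound : Summable fun j =>
        x ^ (1 - ν) * (ν * gevreyTerm ν x (j + 1) + (1 - ν) * gevreyTerm ν x j) :=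
      ((hs'.mul_left _).add (hs.mul_left _)).mul_left _
    have hterm := inv_succ_mul_gevreyTerm_le hν0 hν1 hx
    calc Fgev ν x = ∑' j : ℕ, ((j : ℝ) + 1)⁻¹ * (x * gevreyTerm ν x j) := by
          refine tsum_congr fun j => ?_
          rw [gevreyTerm]
          ring
      _ ≤ ∑' j, x ^ (1 - ν) * (ν * gevreyTerm ν x (j + 1) + (1 - ν) * gevreyTerm ν x j) :=
          (hbound.of_nonneg_of_le (fun j => mul_nonneg (by positivity)
            (mul_nonneg hx (gevreyTerm_nonneg ν hx j))) hterm).tsum_le_tsum hterm hbound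
      _ = x ^ (1 - ν) * (ν * ∑' j, gevreyTerm ν x (j + 1) + (1 - ν) * ∑' j, gevreyTerm ν x j) := by
          rw [tsum_mul_left, (hs'.mul_left _).tsum_add (hs.mul_left _), tsum_mul_left,
            tsum_mul_left]
      _ ≤ x ^ (1 - ν) * ftilde ν x := by
          rw [hf]
          refine mul_le_mul_of_nonneg_left ?_ (Real.rpow_nonneg hx _)
          linarith [mul_le_mul_of_nonneg_left htail hν0.le]
end

section
/- Let 0 < ν ≤ 1. Then for all x ≥ 0 and all a > 0 one has F(a) · (max(x, a))^{ν−1} · exp(ν^{−1}(x^ν − a^ν)) ≤ f̃(x) ≤ exp(ν^{−1} x^ν). (Estimate (A.7) of Lemma A.1.) -/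
/-- The Gevrey coefficients are at most those of the exponential series. -/
lemma gevreyCoeff_le {ν : ℝ} (hν0 : 0 < ν) (hν1 : ν ≤ 1) (j : ℕ) :
    (j.factorial : ℝ) ^ (-(1 / ν)) ≤ ((j.factorial : ℝ))⁻¹ := by
  rw [← Real.rpow_neg_one]
  refine Real.rpow_le_rpow_of_exponent_le (by exact_mod_cast j.factorial_pos) ?_
  have : 1 ≤ 1 / ν := by rwa [le_div_iff₀ hν0, one_mul]
  linarith

lemma gevreyCoeff_nonneg (ν : ℝ) (j : ℕ) : 0 ≤ (j.factorial : ℝ) ^ (-(1 / ν)) := by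
  positivity

lemma summable_ftilde {ν : ℝ} (hν0 : 0 < ν) (hν1 : ν ≤ 1) {x : ℝ} (hx : 0 ≤ x) :
    Summable fun j : ℕ => (j.factorial : ℝ) ^ (-(1 / ν)) * x ^ j := by
  refine Summable.of_nonneg_of_le (fun j => by positivity) (fun j => ?_)
    (Real.summable_pow_div_factorial x)
  rw [div_eq_inv_mul (x ^ j)]
  exact mul_le_mul_of_nonneg_right (gevreyCoeff_le hν0 hν1 j) (by positivity)

lemma summable_deriv_ftilde {ν : ℝ} (hν0 : 0 < ν) (hν1 : ν ≤ 1) {x : ℝ} (hx : 0 ≤ x) :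
    Summable fun j : ℕ => (j.factorial : ℝ) ^ (-(1 / ν)) * (j * x ^ (j - 1)) := by
  rw [← summable_nat_add_iff 1]
  refine Summable.of_nonneg_of_le (fun j => by positivity) (fun j => ?_)
    (Real.summable_pow_div_factorial x)
  refine (mul_le_mul_of_nonneg_right (gevreyCoeff_le hν0 hν1 (j + 1)) (by positivity)).trans
    (le_of_eq ?_)
  have : (j.factorial : ℝ) ≠ 0 := by exact_mod_cast j.factorial_ne_zero
  rw [Nat.factorial_succ, Nat.add_sub_cancel]
  push_cast
  field_simp

lemma hasDerivAt_ftilde {ν : ℝ} (hν0 : 0 < ν) (hν1 : ν ≤ 1) (x : ℝ) :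
    HasDerivAt (ftilde ν) (∑' j : ℕ, (j.factorial : ℝ) ^ (-(1 / ν)) * (j * x ^ (j - 1))) x := by
  have hR : 0 ≤ |x| + 1 := by positivity
  refine hasDerivAt_tsum_of_isPreconnected (𝕜 := ℝ)
    (t := Metric.ball (0 : ℝ) (|x| + 1)) (y₀ := 0)
    (g := fun (j : ℕ) (y : ℝ) => (j.factorial : ℝ) ^ (-(1 / ν)) * y ^ j)
    (g' := fun (j : ℕ) (y : ℝ) => (j.factorial : ℝ) ^ (-(1 / ν)) * (j * y ^ (j - 1)))
    (summable_deriv_ftilde hν0 hν1 hR) Metric.isOpen_ball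
    (convex_ball _ _).isPreconnected (fun j y _ => (hasDerivAt_pow j y).const_mul _)
    (fun j y hy => ?_) (Metric.mem_ball_self (by positivity))
    (summable_ftilde hν0 hν1 le_rfl) (by simp)
  have hy' : |y| ≤ |x| + 1 := by simpa using (mem_ball_zero_iff.1 hy).le
  rw [norm_mul, norm_mul, norm_pow, Real.norm_of_nonneg (gevreyCoeff_nonneg ν j),
    Real.norm_natCast, Real.norm_eq_abs]
  gcongr

lemma hasDerivAt_Fgev {ν : ℝ} (hν0 : 0 < ν) (hν1 : ν ≤ 1) (x : ℝ) :
    HasDerivAt (Fgev ν) (ftilde ν x) x := by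
  have hR : 0 ≤ |x| + 1 := by positivity
  refine hasDerivAt_tsum_of_isPreconnected (𝕜 := ℝ)
    (t := Metric.ball (0 : ℝ) (|x| + 1)) (y₀ := 0)
    (g := fun (j : ℕ) (y : ℝ) => ((j : ℝ) + 1)⁻¹ * (j.factorial : ℝ) ^ (-(1 / ν)) * y ^ (j + 1))
    (g' := fun (j : ℕ) (y : ℝ) => (j.factorial : ℝ) ^ (-(1 / ν)) * y ^ j)
    (summable_ftilde hν0 hν1 hR) Metric.isOpen_ball
    (convex_ball _ _).isPreconnected (fun j y _ => ?_)
    (fun j y hy => ?_) (Metric.mem_ball_self (by positivity))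
    (by simp) (by simp)
  · refine ((hasDerivAt_pow (j + 1) y).const_mul
      (((j : ℝ) + 1)⁻¹ * (j.factorial : ℝ) ^ (-(1 / ν)))).congr_deriv ?_
    have : (j : ℝ) + 1 ≠ 0 := by positivity
    push_cast
    field_simp
  · have hy' : |y| ≤ |x| + 1 := by simpa using (mem_ball_zero_iff.1 hy).le
    rw [norm_mul, norm_pow, Real.norm_of_nonneg (gevreyCoeff_nonneg ν j), Real.norm_eq_abs]
    gcongr

/-- Consecutive terms of the series `ftilde ν x` have ratio `u` with `u ^ ν = x ^ ν / (j + 1)`. -/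
lemma exists_gevrey_ratio {ν : ℝ} (hν0 : 0 < ν) {x : ℝ} (hx : 0 < x) (j : ℕ) :
    ∃ u : ℝ, 0 < u ∧ u ^ ν = x ^ ν / (j + 1) ∧
      ((j + 1).factorial : ℝ) ^ (-(1 / ν)) * x ^ (j + 1) =
        (j.factorial : ℝ) ^ (-(1 / ν)) * x ^ j * u := by
  have hj : (0 : ℝ) < j + 1 := by positivity
  refine ⟨x * ((j : ℝ) + 1) ^ (-(1 / ν)), by positivity, ?_, ?_⟩
  · rw [Real.mul_rpow hx.le (by positivity), ← Real.rpow_mul hj.le,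
      show -(1 / ν) * ν = -1 by field_simp, Real.rpow_neg_one, div_eq_mul_inv]
  · rw [Nat.factorial_succ, Nat.cast_mul, Real.mul_rpow (by positivity) (by positivity)]
    push_cast
    ring

lemma gevrey_term_lower {ν : ℝ} (hν0 : 0 < ν) (hν1 : ν ≤ 1) {x : ℝ} (hx : 0 < x) (j : ℕ) :
    x ^ (ν - 1) * (((j : ℝ) + 1)⁻¹ * (j.factorial : ℝ) ^ (-(1 / ν)) * x ^ (j + 1)) ≤
      (1 - ν) * ((j.factorial : ℝ) ^ (-(1 / ν)) * x ^ j) +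
        ν * (((j + 1).factorial : ℝ) ^ (-(1 / ν)) * x ^ (j + 1)) := by
  obtain ⟨u, hu, huν, hw⟩ := exists_gevrey_ratio hν0 hx j
  have young := Real.geom_mean_le_arith_mean2_weighted (sub_nonneg.2 hν1) hν0.le
    zero_le_one hu.le (by ring)
  rw [Real.one_rpow, one_mul, huν] at young
  have := mul_le_mul_of_nonneg_left young
    (show 0 ≤ (j.factorial : ℝ) ^ (-(1 / ν)) * x ^ j by positivity)
  rw [hw, Real.rpow_sub_one hx.ne']
  refine le_trans (le_of_eq ?_) (this.trans (le_of_eq (by ring)))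
  field_simp
  ring

lemma gevrey_term_upper {ν : ℝ} (hν0 : 0 < ν) (hν1 : ν ≤ 1) {x : ℝ} (hx : 0 < x) (j : ℕ) :
    ((j + 1).factorial : ℝ) ^ (-(1 / ν)) * (((j + 1 : ℕ) : ℝ) * x ^ j) ≤
      x ^ (ν - 1) * (ν * ((j.factorial : ℝ) ^ (-(1 / ν)) * x ^ j) +
        (1 - ν) * (((j + 1).factorial : ℝ) ^ (-(1 / ν)) * x ^ (j + 1))) := by
  obtain ⟨u, hu, huν, hw⟩ := exists_gevrey_ratio hν0 hx j
  have young := Real.geom_mean_le_arith_mean2_weighted hν0.le (sub_nonneg.2 hν1)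
    zero_le_one hu.le (by ring)
  rw [Real.one_rpow, one_mul, Real.rpow_sub hu, Real.rpow_one, huν] at young
  have hxν : 0 < x ^ ν := by positivity
  have hj : (0 : ℝ) < j + 1 := by positivity
  have := mul_le_mul_of_nonneg_left young
    (show 0 ≤ x ^ (ν - 1) * ((j.factorial : ℝ) ^ (-(1 / ν)) * x ^ j) by positivity)
  have hw' : ((j + 1).factorial : ℝ) ^ (-(1 / ν)) * x ^ j =
      (j.factorial : ℝ) ^ (-(1 / ν)) * x ^ j * u / x := by
    rw [← hw, pow_succ]
    field_simp
  rw [hw]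
  refine le_trans (le_of_eq ?_) (this.trans (le_of_eq (by ring)))
  rw [Real.rpow_sub_one hx.ne', mul_left_comm, hw']
  push_cast
  field_simp

lemma ftilde_eq_zero_add {ν : ℝ} (hν0 : 0 < ν) (hν1 : ν ≤ 1) {x : ℝ} (hx : 0 ≤ x) :
    ftilde ν x = 1 + ∑' j : ℕ, ((j + 1).factorial : ℝ) ^ (-(1 / ν)) * x ^ (j + 1) := by
  rw [ftilde, (summable_ftilde hν0 hν1 hx).tsum_eq_zero_add]
  simp

lemma rpow_mul_Fgev_le_ftilde {ν : ℝ} (hν0 : 0 < ν) (hν1 : ν ≤ 1) {x : ℝ} (hx : 0 < x) :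
    x ^ (ν - 1) * Fgev ν x ≤ ftilde ν x := by
  have hs := summable_ftilde hν0 hν1 hx.le
  have hs' := (summable_nat_add_iff 1).2 hs
  have hsum := (hs.mul_left (1 - ν)).add (hs'.mul_left ν)
  have h0 := ftilde_eq_zero_add hν0 hν1 hx.le
  calc x ^ (ν - 1) * Fgev ν x
      = ∑' j : ℕ, x ^ (ν - 1) *
          (((j : ℝ) + 1)⁻¹ * (j.factorial : ℝ) ^ (-(1 / ν)) * x ^ (j + 1)) := by
        rw [Fgev, tsum_mul_left]
    _ ≤ _ := (Summable.of_nonneg_of_le (fun j => by positivity)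
          (gevrey_term_lower hν0 hν1 hx) hsum).tsum_le_tsum (gevrey_term_lower hν0 hν1 hx) hsum
    _ = (1 - ν) * ftilde ν x + ν * (ftilde ν x - 1) := by
        rw [(hs.mul_left (1 - ν)).tsum_add (hs'.mul_left ν), tsum_mul_left, tsum_mul_left,
          ← ftilde, h0, add_sub_cancel_left]
    _ ≤ ftilde ν x := by linarith

lemma deriv_ftilde_le {ν : ℝ} (hν0 : 0 < ν) (hν1 : ν ≤ 1) {x : ℝ} (hx : 0 < x) :
    ∑' j : ℕ, (j.factorial : ℝ) ^ (-(1 / ν)) * (j * x ^ (j - 1)) ≤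
      x ^ (ν - 1) * ftilde ν x := by
  have hs := summable_ftilde hν0 hν1 hx.le
  have hs' := (summable_nat_add_iff 1).2 hs
  have hd := summable_deriv_ftilde hν0 hν1 hx.le
  have hsum := ((hs.mul_left ν).add (hs'.mul_left (1 - ν))).mul_left (x ^ (ν - 1))
  have h0 := ftilde_eq_zero_add hν0 hν1 hx.le
  have hxν : 0 < x ^ (ν - 1) := by positivity
  rw [hd.tsum_eq_zero_add, Nat.cast_zero, zero_mul, mul_zero, zero_add]
  refine (((summable_nat_add_iff 1).2 hd).tsum_le_tsum
    (gevrey_term_upper hν0 hν1 hx) hsum).trans ?_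
  rw [tsum_mul_left, (hs.mul_left ν).tsum_add (hs'.mul_left (1 - ν)), tsum_mul_left, tsum_mul_left]
  refine mul_le_mul_of_nonneg_left ?_ hxν.le
  rw [← ftilde]
  nlinarith

lemma hasDerivAt_mul_exp_neg_rpow {ν : ℝ} (hν0 : 0 < ν) {x : ℝ} (hx : 0 < x) {f : ℝ → ℝ} {f' : ℝ}
    (hf : HasDerivAt f f' x) :
    HasDerivAt (fun y => f y * Real.exp (-(ν⁻¹ * y ^ ν)))
      ((f' - x ^ (ν - 1) * f x) * Real.exp (-(ν⁻¹ * x ^ ν))) x := by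
  refine (hf.mul ((((Real.hasDerivAt_rpow_const (p := ν) (Or.inl hx.ne')).const_mul
    ν⁻¹).neg).exp)).congr_deriv ?_
  simp only [Pi.neg_apply]
  field_simp
  ring

lemma antitoneOn_ftilde_mul_exp {ν : ℝ} (hν0 : 0 < ν) (hν1 : ν ≤ 1) :
    AntitoneOn (fun y => ftilde ν y * Real.exp (-(ν⁻¹ * y ^ ν))) (Set.Ici 0) := by
  have hd := fun x (hx : x ∈ interior (Set.Ici (0 : ℝ))) =>
    hasDerivAt_mul_exp_neg_rpow hν0 (by simpa using hx) (hasDerivAt_ftilde hν0 hν1 x)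
  refine antitoneOn_of_deriv_nonpos (convex_Ici 0) ?_
    (fun x hx => (hd x hx).differentiableAt.differentiableWithinAt) fun x hx => ?_
  · have hf : Continuous (ftilde ν) :=
      continuous_iff_continuousAt.2 fun x => (hasDerivAt_ftilde hν0 hν1 x).continuousAt
    have hp := Real.continuous_rpow_const (q := ν) hν0.le
    fun_prop
  · rw [(hd x hx).deriv]
    exact mul_nonpos_of_nonpos_of_nonneg
      (sub_nonpos.2 (deriv_ftilde_le hν0 hν1 (by simpa using hx))) (Real.exp_pos _).le

lemma monotoneOn_Fgev_mul_exp {ν : ℝ} (hν0 : 0 < ν) (hν1 : ν ≤ 1) :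
    MonotoneOn (fun y => Fgev ν y * Real.exp (-(ν⁻¹ * y ^ ν))) (Set.Ioi 0) := by
  have hd := fun x (hx : x ∈ Set.Ioi (0 : ℝ)) =>
    hasDerivAt_mul_exp_neg_rpow hν0 hx (hasDerivAt_Fgev hν0 hν1 x)
  refine monotoneOn_of_deriv_nonneg (convex_Ioi 0)
    (fun x hx => (hd x hx).continuousAt.continuousWithinAt)
    (fun x hx => (hd x (interior_subset hx)).differentiableAt.differentiableWithinAt)
    fun x hx => ?_
  have hx := interior_subset hx
  rw [(hd x hx).deriv]
  exact mul_nonneg (sub_nonneg.2 (rpow_mul_Fgev_le_ftilde hν0 hν1 hx)) (Real.exp_pos _).le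

/-- Estimate (A.7) of Lemma A.1: for `0 < ν ≤ 1`, `x ≥ 0` and `a > 0`,
`F(a) (max(x, a))^{ν−1} exp(ν⁻¹(x^ν − a^ν)) ≤ f̃(x) ≤ exp(ν⁻¹ x^ν)`. -/
theorem stmt17 (ν : ℝ) (hν0 : 0 < ν) (hν1 : ν ≤ 1) (x : ℝ) (hx : 0 ≤ x) (a : ℝ) (ha : 0 < a) :
    Fgev ν a * max x a ^ (ν - 1) * Real.exp (ν⁻¹ * (x ^ ν - a ^ ν)) ≤ ftilde ν x ∧
    ftilde ν x ≤ Real.exp (ν⁻¹ * x ^ ν) := by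
  have hexp : Real.exp (ν⁻¹ * (x ^ ν - a ^ ν)) =
      Real.exp (-(ν⁻¹ * a ^ ν)) * Real.exp (ν⁻¹ * x ^ ν) := by
    rw [← Real.exp_add]
    ring_nf
  have hcancel (c : ℝ) : c * Real.exp (-(ν⁻¹ * x ^ ν)) * Real.exp (ν⁻¹ * x ^ ν) = c := by
    rw [mul_assoc, ← Real.exp_add, neg_add_cancel, Real.exp_zero, mul_one]
  have hE := (Real.exp_pos (ν⁻¹ * x ^ ν)).le
  constructor
  · rw [hexp]
    rcases le_total a x with hax | hxa
    · have hx0 := ha.trans_le hax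
      have hmono := monotoneOn_Fgev_mul_exp hν0 hν1 ha hx0 hax
      have hF := mul_le_mul_of_nonneg_right hmono hE
      simp only [hcancel] at hF
      rw [max_eq_left hax]
      calc _ = x ^ (ν - 1) *
            (Fgev ν a * Real.exp (-(ν⁻¹ * a ^ ν)) * Real.exp (ν⁻¹ * x ^ ν)) := by ring
        _ ≤ x ^ (ν - 1) * Fgev ν x := mul_le_mul_of_nonneg_left hF (by positivity)
        _ ≤ _ := rpow_mul_Fgev_le_ftilde hν0 hν1 hx0
    · have hanti := antitoneOn_ftilde_mul_exp hν0 hν1 hx ha.le hxa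
      have hf := mul_le_mul_of_nonneg_right hanti hE
      simp only [hcancel] at hf
      rw [max_eq_right hxa]
      calc _ = a ^ (ν - 1) * Fgev ν a *
            (Real.exp (-(ν⁻¹ * a ^ ν)) * Real.exp (ν⁻¹ * x ^ ν)) := by ring
        _ ≤ ftilde ν a * (Real.exp (-(ν⁻¹ * a ^ ν)) * Real.exp (ν⁻¹ * x ^ ν)) :=
            mul_le_mul_of_nonneg_right (rpow_mul_Fgev_le_ftilde hν0 hν1 ha) (by positivity)
        _ ≤ _ := by rwa [← mul_assoc]
  · have hf := mul_le_mul_of_nonneg_right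
      (antitoneOn_ftilde_mul_exp hν0 hν1 Set.self_mem_Ici hx hx) hE
    have h0 : ftilde ν 0 = 1 := by simp [ftilde_eq_zero_add hν0 hν1 le_rfl]
    simpa only [hcancel, h0, Real.zero_rpow hν0.ne', mul_zero, neg_zero, Real.exp_zero,
      one_mul] using hf
end
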